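/- arXiv:2506.01167 — 5 statements merged into one kernel-verified Lean document; each statement's English description precedes it below -/
import Mathlib

section
/- Let Q be a finite set and δ_ε : Q → Finset Q a map assigning to each state its set of ε-successors. Let q : Q → ℝ be a probability vector over Q and q^ε : Q → ℝ a probability vector over Q (the probabilities of taking the ε-actions leading to the corresponding states). Define the ε-update q' : Q → ℝ by q'_{y} := (∑_{x ∈ Q, y ∈ δ_ε(x)} q_x · q^ε_y) + q_y · (∑_{x ∈ Q, x ∉ δ_ε(y)} q^ε_x). Then q' is again a probability vector: q'_y ≥ 0 for all y and ∑_{y ∈ Q} q'_y = 1. -/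
/-- The soft ε-transition update preserves probability vectors: for `δε : Q → Finset Q`
and probability vectors `q` (current state distribution) and `qε` (ε-action distribution),
`q' y = (∑_{x : y ∈ δε x} q x * qε y) + q y * ∑_{x ∉ δε y} qε x`
is again a probability vector. -/
theorem epsilon_transition_update_is_probability_vector
    {Q : Type*} [Fintype Q] [DecidableEq Q]
    (δε : Q → Finset Q) (q qε : Q → ℝ)
    (hq0 : ∀ x, 0 ≤ q x) (hq1 : ∑ x, q x = 1)
    (hqε0 : ∀ x, 0 ≤ qε x) (hqε1 : ∑ x, qε x = 1) :
    (∀ y, 0 ≤ (∑ x ∈ Finset.univ.filter (fun x => y ∈ δε x), q x * qε y) +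
        q y * ∑ x ∈ Finset.univ.filter (fun x => x ∉ δε y), qε x) ∧
    ∑ y, ((∑ x ∈ Finset.univ.filter (fun x => y ∈ δε x), q x * qε y) +
        q y * ∑ x ∈ Finset.univ.filter (fun x => x ∉ δε y), qε x) = 1 := by
  refine ⟨fun y => add_nonneg
    (Finset.sum_nonneg fun x _ => mul_nonneg (hq0 x) (hqε0 y))
    (mul_nonneg (hq0 y) (Finset.sum_nonneg fun x _ => hqε0 x)), ?_⟩
  have hswap : ∑ y, ∑ x ∈ Finset.univ.filter (fun x => y ∈ δε x), q x * qε y =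
      ∑ x, q x * ∑ y ∈ Finset.univ.filter (fun y => y ∈ δε x), qε y := by
    simp only [Finset.sum_filter, Finset.mul_sum, mul_ite, mul_zero]
    exact Finset.sum_comm
  rw [Finset.sum_add_distrib, hswap, ← Finset.sum_add_distrib, ← hq1]
  refine Finset.sum_congr rfl fun x _ => ?_
  rw [← mul_add, Finset.sum_filter_add_sum_filter_not, hqε1, mul_one]
end

section
/- Let R, Γ : ℕ → ℝ be sequences satisfying 0 ≤ R_t ≤ 1 − Γ_t and 0 < Γ_t ≤ 1 for all t. Then for every horizon H ∈ ℕ, the discounted return ∑_{t=0}^{H−1} R_t · ∏_{i=0}^{t−1} Γ_i satisfies ∑_{t=0}^{H−1} R_t · ∏_{i<t} Γ_i ≤ 1 − ∏_{t=0}^{H−1} Γ_t; in particular it lies in [0,1]. (The empty product ∏_{i<0} Γ_i is 1.) -/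
/-- Discounted returns with state-dependent discounting are bounded: if `0 ≤ R t ≤ 1 - Γ t`
and `0 < Γ t ≤ 1` for all `t`, then for every horizon `H`,
`∑_{t<H} R t · ∏_{i<t} Γ i ≤ 1 - ∏_{t<H} Γ t`, and in particular the return lies in `[0,1]`. -/
theorem discounted_return_bounds
    (R Γ : ℕ → ℝ)
    (hR : ∀ t, 0 ≤ R t ∧ R t ≤ 1 - Γ t)
    (hΓ : ∀ t, 0 < Γ t ∧ Γ t ≤ 1) :
    ∀ H : ℕ,
      (∑ t ∈ Finset.range H, R t * ∏ i ∈ Finset.range t, Γ i ≤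
        1 - ∏ t ∈ Finset.range H, Γ t) ∧
      0 ≤ ∑ t ∈ Finset.range H, R t * ∏ i ∈ Finset.range t, Γ i ∧
      ∑ t ∈ Finset.range H, R t * ∏ i ∈ Finset.range t, Γ i ≤ 1 := by
  intro H
  have hprod : ∀ n, 0 ≤ ∏ i ∈ Finset.range n, Γ i := fun n =>
    Finset.prod_nonneg fun i _ => (hΓ i).1.le
  have hle : ∑ t ∈ Finset.range H, R t * ∏ i ∈ Finset.range t, Γ i ≤
      1 - ∏ t ∈ Finset.range H, Γ t := by
    induction H with
    | zero => simp
    | succ n ih =>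
      rw [Finset.sum_range_succ, Finset.prod_range_succ]
      linarith [mul_le_mul_of_nonneg_right (hR n).2 (hprod n)]
  exact ⟨hle, Finset.sum_nonneg fun t _ => mul_nonneg (hR t).1 (hprod t),
    hle.trans (sub_le_self 1 (hprod H))⟩
end

section
/- Let b : ℕ → Bool and β, γ ∈ (0,1). Define R_t := (1−β) if b_t = true and R_t := 0 otherwise, and Γ_t := β if b_t = true and Γ_t := γ otherwise. Then the infinite series ∑_{t=0}^{∞} R_t · ∏_{i=0}^{t−1} Γ_i is summable and its sum G lies in the interval [0, 1]. -/
/-- If each reward plus the discount of the same step is at most `1`, then every partial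
discounted return plus the remaining discount is at most `1`. -/
theorem sum_range_mul_prod_add_prod_le_one {r g : ℕ → ℝ} (hg : ∀ t, 0 ≤ g t)
    (hrg : ∀ t, r t + g t ≤ 1) (n : ℕ) :
    ∑ t ∈ Finset.range n, r t * ∏ i ∈ Finset.range t, g i + ∏ i ∈ Finset.range n, g i ≤ 1 := by
  induction n with
  | zero => simp
  | succ n ih =>
    rw [Finset.sum_range_succ, Finset.prod_range_succ]
    have hp : 0 ≤ ∏ i ∈ Finset.range n, g i := Finset.prod_nonneg fun i _ => hg i
    nlinarith [mul_le_mul_of_nonneg_right (hrg n) hp]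

/-- The Büchi-condition return series is summable with sum in `[0,1]`:
with `R t = (1-β)` at accepting steps (`b t = true`) and `0` otherwise, and
`Γ t = β` at accepting steps and `γ` otherwise, for `β, γ ∈ (0,1)`,
the series `∑_{t} R t · ∏_{i<t} Γ i` is summable and its sum lies in `[0,1]`. -/
theorem buchi_return_summable_and_bounded
    (b : ℕ → Bool) (β γ : ℝ) (hβ : 0 < β ∧ β < 1) (hγ : 0 < γ ∧ γ < 1) :
    Summable (fun t : ℕ =>
      (if b t then 1 - β else 0) * ∏ i ∈ Finset.range t, (if b i then β else γ)) ∧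
    (0 ≤ ∑' t : ℕ,
      (if b t then 1 - β else 0) * ∏ i ∈ Finset.range t, (if b i then β else γ)) ∧
    ((∑' t : ℕ,
      (if b t then 1 - β else 0) * ∏ i ∈ Finset.range t, (if b i then β else γ)) ≤ 1) := by
  have hg : ∀ t, (0 : ℝ) ≤ if b t then β else γ := fun t => by
    split_ifs
    exacts [hβ.1.le, hγ.1.le]
  have hrg : ∀ t, (if b t then 1 - β else 0) + (if b t then β else γ) ≤ 1 := fun t => by
    split_ifs <;> linarith [hγ.2]
  have hnonneg : ∀ t, 0 ≤ (if b t then 1 - β else 0) *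
      ∏ i ∈ Finset.range t, (if b i then β else γ) := fun t => by
    refine mul_nonneg ?_ (Finset.prod_nonneg fun i _ => hg i)
    split_ifs <;> linarith [hβ.2]
  have hsum : ∀ n, ∑ t ∈ Finset.range n, (if b t then 1 - β else 0) *
      ∏ i ∈ Finset.range t, (if b i then β else γ) ≤ 1 := fun n =>
    (le_add_of_nonneg_right (Finset.prod_nonneg fun i _ => hg i)).trans
      (sum_range_mul_prod_add_prod_le_one hg hrg n)
  exact ⟨summable_of_sum_range_le hnonneg hsum, tsum_nonneg hnonneg,
    Real.tsum_le_of_sum_range_le hnonneg hsum⟩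
end

section
/- Let b : ℕ → Bool be such that the set {t : b_t = true} is infinite, and fix β ∈ (0,1). For γ ∈ (0,1) define G(γ) := ∑_{t=0}^{∞} R_t · ∏_{i=0}^{t−1} Γ_i(γ), where R_t := (1−β) if b_t = true and 0 otherwise, and Γ_t(γ) := β if b_t = true and γ otherwise. Then G(γ) tends to 1 as γ tends to 1 from the left; i.e., lim_{γ → 1⁻} G(γ) = 1. -/
/-- A product with factor `β` at the indices satisfying `p` and `1` elsewhere is a power of `β`. -/
theorem prod_range_ite_one_eq_pow_count {M : Type*} [CommMonoid M] (p : ℕ → Prop)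
    [DecidablePred p] (β : M) (n : ℕ) :
    ∏ i ∈ Finset.range n, (if p i then β else 1) = β ^ Nat.count p n := by
  rw [← Finset.prod_filter, Finset.prod_const, Nat.count_eq_card_filter_range]

theorem tendsto_count_atTop_of_infinite (p : ℕ → Prop) [DecidablePred p]
    (hp : {n | p n}.Infinite) : Filter.Tendsto (Nat.count p) Filter.atTop Filter.atTop :=
  Filter.tendsto_atTop_atTop_of_monotone (Nat.count_monotone p) fun n =>
    ⟨Nat.nth p n, (Nat.count_nth_of_infinite hp n).ge⟩

/-- At `γ = 1` the Büchi-condition return telescopes to `1`. -/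
theorem hasSum_buchi_return_one (b : ℕ → Bool) (hb : {t : ℕ | b t = true}.Infinite)
    (β : ℝ) (h0 : 0 ≤ β) (h1 : β < 1) :
    HasSum (fun t : ℕ => (if b t then 1 - β else 0) *
      ∏ i ∈ Finset.range t, (if b i then β else 1)) 1 := by
  have hP : ∀ n, 0 ≤ ∏ i ∈ Finset.range n, (if b i then β else 1) := fun n =>
    Finset.prod_nonneg fun i _ => by split_ifs <;> linarith
  rw [hasSum_iff_tendsto_nat_of_nonneg
    fun t => mul_nonneg (by split_ifs <;> linarith) (hP t)]
  have hstep : ∀ t, (if b t then 1 - β else 0) * ∏ i ∈ Finset.range t, (if b i then β else 1) =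
      ∏ i ∈ Finset.range t, (if b i then β else 1) -
        ∏ i ∈ Finset.range (t + 1), (if b i then β else 1) := fun t => by
    rw [Finset.prod_range_succ]
    split_ifs <;> ring
  simp only [hstep, Finset.sum_range_sub']
  simp only [prod_range_ite_one_eq_pow_count]
  simpa using ((tendsto_pow_atTop_nhds_zero_of_lt_one h0 h1).comp
    (tendsto_count_atTop_of_infinite (fun t => b t = true) hb)).const_sub 1

/-- If the Büchi acceptance condition holds (accepting states are visited infinitely often,
i.e. `b t = true` for infinitely many `t`), then the Büchi-condition return
`G(γ) = ∑_t R t · ∏_{i<t} Γ i (γ)` — with `R t = (1-β)` and `Γ t (γ) = β` at accepting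
steps, and `R t = 0`, `Γ t (γ) = γ` at non-accepting steps — tends to `1` as `γ → 1⁻`. -/
theorem buchi_return_tendsto_one_of_infinitely_accepting
    (b : ℕ → Bool) (hb : {t : ℕ | b t = true}.Infinite)
    (β : ℝ) (hβ : 0 < β ∧ β < 1) :
    Filter.Tendsto (fun γ : ℝ => ∑' t : ℕ,
        (if b t then 1 - β else 0) * ∏ i ∈ Finset.range t, (if b i then β else γ))
      (nhdsWithin 1 (Set.Iio (1 : ℝ))) (nhds 1) := by
  obtain ⟨h0, h1⟩ := hβ
  have hsum := hasSum_buchi_return_one b hb β h0.le h1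
  suffices h : Filter.Tendsto _ _ (nhds (∑' t : ℕ, (if b t then 1 - β else 0) *
      ∏ i ∈ Finset.range t, (if b i then β else 1))) by rwa [hsum.tsum_eq] at h
  refine tendsto_tsum_of_dominated_convergence hsum.summable (fun t => ?_) ?_
  · have hcont : Continuous fun γ : ℝ =>
        (if b t then 1 - β else 0) * ∏ i ∈ Finset.range t, (if b i then β else γ) :=
      continuous_const.mul <| continuous_finsetProd _ fun i _ =>
        continuous_const.if_const _ continuous_id
    exact (hcont.tendsto 1).mono_left nhdsWithin_le_nhds
  · filter_upwards [Ioo_mem_nhdsLT (zero_lt_one (α := ℝ))] with γ hγ t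
    have hfac : ∀ i, 0 ≤ (if b i then β else γ) := fun i => by
      split_ifs
      exacts [h0.le, hγ.1.le]
    have hrew : 0 ≤ (if b t then 1 - β else 0) := by split_ifs <;> linarith
    rw [Real.norm_of_nonneg (mul_nonneg hrew (Finset.prod_nonneg fun i _ => hfac i))]
    refine mul_le_mul_of_nonneg_left (Finset.prod_le_prod (fun i _ => hfac i) fun i _ => ?_) hrew
    split_ifs
    exacts [le_rfl, hγ.2.le]
end

section
/- Let b : ℕ → Bool be such that the set {t : b_t = true} is finite with exactly n elements, and let β, γ ∈ (0,1). Define G := ∑_{t=0}^{∞} R_t · ∏_{i=0}^{t−1} Γ_i, where R_t := (1−β) if b_t = true and 0 otherwise, and Γ_t := β if b_t = true and γ otherwise. Then G ≤ 1 − β^n. In particular, G → 0 as β → 1 uniformly in γ for paths with a bounded number of accepting visits. -/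
/-- The discount accumulated up to time `T` is at most `β` to the number of accepting visits. -/
theorem prod_discount_le_pow_count (b : ℕ → Bool) {β γ : ℝ} (hβ : 0 ≤ β)
    (hγ : 0 ≤ γ) (hγ1 : γ ≤ 1) (T : ℕ) :
    ∏ i ∈ Finset.range T, (if b i then β else γ) ≤ β ^ Nat.count (fun t => b t = true) T := by
  induction T with
  | zero => simp
  | succ T ih =>
    rw [Finset.prod_range_succ, Nat.count_succ, pow_add]
    refine mul_le_mul ih ?_ (by split_ifs <;> assumption) (by positivity)
    split_ifs
    · simp
    · simpa using hγ1

/-- The return collected before time `T` is at most `1 - β ^ k`, with `k` the number of accepting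
visits before `T`. -/
theorem sum_return_le_one_sub_pow_count (b : ℕ → Bool) {β γ : ℝ} (hβ : 0 ≤ β) (hβ1 : β ≤ 1)
    (hγ : 0 ≤ γ) (hγ1 : γ ≤ 1) (T : ℕ) :
    ∑ t ∈ Finset.range T,
      (if b t then 1 - β else 0) * ∏ i ∈ Finset.range t, (if b i then β else γ) ≤
      1 - β ^ Nat.count (fun t => b t = true) T := by
  induction T with
  | zero => simp
  | succ T ih =>
    rw [Finset.sum_range_succ, Nat.count_succ]
    split_ifs
    · have h := mul_le_mul_of_nonneg_left (prod_discount_le_pow_count b hβ hγ hγ1 T)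
        (sub_nonneg.2 hβ1)
      rw [pow_succ]
      linarith
    · simpa using ih

/-- If accepting states are visited only finitely often — exactly `n` times — then the
Büchi-condition return `G = ∑_t R t · ∏_{i<t} Γ i`, with `R t = (1-β)` and `Γ t = β` at
accepting steps (`b t = true`) and `R t = 0`, `Γ t = γ` at non-accepting steps, satisfies
`G ≤ 1 - β ^ n`. -/
theorem buchi_return_le_of_finitely_accepting
    (b : ℕ → Bool) (n : ℕ) (hb : {t : ℕ | b t = true}.Finite)
    (hn : hb.toFinset.card = n)
    (β γ : ℝ) (hβ : 0 < β ∧ β < 1) (hγ : 0 < γ ∧ γ < 1) :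
    (∑' t : ℕ,
      (if b t then 1 - β else 0) * ∏ i ∈ Finset.range t, (if b i then β else γ)) ≤
      1 - β ^ n := by
  refine Real.tsum_le_of_sum_range_le (fun t => ?_) (fun T => ?_)
  · have hR : (0 : ℝ) ≤ if b t then 1 - β else 0 := by split_ifs <;> linarith
    refine mul_nonneg hR (Finset.prod_nonneg fun i _ => ?_)
    split_ifs <;> linarith
  · refine (sum_return_le_one_sub_pow_count b hβ.1.le hβ.2.le hγ.1.le hγ.2.le T).trans ?_
    have hcount : Nat.count (fun t => b t = true) T ≤ n := by
      rw [Nat.count_eq_card_filter_range, ← hn]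
      exact Finset.card_le_card fun t ht => by simpa using (Finset.mem_filter.1 ht).2
    exact sub_le_sub_left (pow_le_pow_of_le_one hβ.1.le hβ.2.le hcount) 1
end
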